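/- Let V be a finite set, E a nonempty finite set of undirected edges on V (parallel edges allowed), B ⊆ V, b : B → ℤ≥0, and let f be an integer-valued skew supermodular biset function on V. Let γ = max{|Γ(Ŝ)| : Ŝ a biset on V with f(Ŝ) > 0} (γ = 0 if no such biset exists). Suppose that every edge in E is incident to some node in B. Then for any extreme point x* of P(f,b,E), there is an edge e ∈ E with x*(e) = 0 or x*(e) ≥ 1/2, or there is a node v ∈ B with |δ_E(v)| ≤ 1.5γ² + 7.5γ + 16. -/

import Mathlib

noncomputable section

attribute [local instance] Classical.propDecidable

/-- A biset on `V`: an ordered pair of finsets `inner ⊆ outer`. -/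
structure Biset (V : Type*) where
  inner : Finset V
  outer : Finset V
  subset : inner ⊆ outer

namespace Biset

variable {V : Type*} [DecidableEq V]

instance [Fintype V] : Fintype (Biset V) :=
  Fintype.ofInjective (fun A => (A.inner, A.outer))
    (fun A B h => by
      cases A; cases B
      simp only [Prod.mk.injEq] at h
      cases h.1; cases h.2; rfl)

/-- The boundary `Γ(Ŝ) = S⁺ ∖ S`. -/
def boundary (A : Biset V) : Finset V := A.outer \ A.inner

def inter (A B : Biset V) : Biset V :=
  ⟨A.inner ∩ B.inner, A.outer ∩ B.outer, Finset.inter_subset_inter A.subset B.subset⟩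

def union (A B : Biset V) : Biset V :=
  ⟨A.inner ∪ B.inner, A.outer ∪ B.outer, Finset.union_subset_union A.subset B.subset⟩

def diff (A B : Biset V) : Biset V :=
  ⟨A.inner \ B.outer, A.outer \ B.inner, Finset.sdiff_subset_sdiff A.subset B.subset⟩

/-- Biset containment: `X̂ ⊆ Ŷ` iff `X ⊆ Y` and `X⁺ ⊆ Y⁺`. -/
def Sub (A B : Biset V) : Prop := A.inner ⊆ B.inner ∧ A.outer ⊆ B.outer

def Laminar (L : Finset (Biset V)) : Prop :=
  ∀ A ∈ L, ∀ B ∈ L, Sub A B ∨ Sub B A ∨ A.inner ∩ B.inner = ∅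

def StronglyLaminar (L : Finset (Biset V)) : Prop :=
  ∀ A ∈ L, ∀ B ∈ L, Sub A B ∨ Sub B A ∨
    (A.inner ∩ B.outer = ∅ ∧ B.inner ∩ A.outer = ∅)

def IntersectingSupermodular (f : Biset V → ℤ) : Prop :=
  ∀ A B : Biset V, (A.inner ∩ B.inner).Nonempty →
    f A + f B ≤ f (inter A B) + f (union A B)

def SkewSupermodular (f : Biset V → ℤ) : Prop :=
  ∀ A B : Biset V,
    f A + f B ≤ f (inter A B) + f (union A B) ∨
    f A + f B ≤ f (diff A B) + f (diff B A)

def vertexBiset (v : V) : Biset V := ⟨{v}, {v}, Finset.Subset.refl _⟩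

end Biset

/-- `γ = max { |Γ(Ŝ)| : f(Ŝ) > 0 }` (0 if no such biset exists). -/
def gammaOf {V : Type*} [Fintype V] [DecidableEq V] (f : Biset V → ℤ) : ℕ :=
  (Finset.univ.filter fun A : Biset V => 0 < f A).sup fun A => (Biset.boundary A).card

/-- The leaves (inclusion-minimal members) of a biset family. -/
def leaves {V : Type*} (L : Finset (Biset V)) : Finset (Biset V) :=
  L.filter fun A => ∀ B ∈ L, Biset.Sub B A → B = A

/-- `max_{Ŝ ∈ L} |Γ(Ŝ)|` (0 if `L` is empty). -/
def gammaL {V : Type*} [DecidableEq V] (L : Finset (Biset V)) : ℕ :=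
  L.sup fun A => (Biset.boundary A).card

section Undirected

variable {V E : Type*} [Fintype V] [DecidableEq V] [Fintype E]

/-- `δ_E(Ŝ)`: undirected edges covering the biset
(one end-node in the inner part, the other outside the outer part). -/
def uDelta (ep1 ep2 : E → V) (A : Biset V) : Finset E :=
  Finset.univ.filter fun e =>
    (ep1 e ∈ A.inner ∧ ep2 e ∉ A.outer) ∨ (ep2 e ∈ A.inner ∧ ep1 e ∉ A.outer)

/-- `δ_E(v) = δ_E(({v},{v}))`. -/
def uDeg (ep1 ep2 : E → V) (v : V) : Finset E :=
  uDelta ep1 ep2 (Biset.vertexBiset v)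

/-- The polytope `P(f,b,E)` for undirected edges. -/
def undirP (ep1 ep2 : E → V) (f : Biset V → ℤ) (B : Finset V) (b : V → ℕ) :
    Set (E → ℝ) :=
  {x | (∀ e : E, 0 ≤ x e ∧ x e ≤ 1) ∧
       (∀ A : Biset V, (f A : ℝ) ≤ ∑ e ∈ uDelta ep1 ep2 A, x e) ∧
       (∀ v ∈ B, ∑ e ∈ uDeg ep1 ep2 v, x e ≤ (b v : ℝ))}

/-- Incidence vector of an edge set. -/
def incVec (F : Finset E) : E → ℝ := fun e => if e ∈ F then 1 else 0

end Undirected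

namespace Biset

variable {V : Type*}

lemma ext_parts {A B : Biset V} (h₁ : A.inner = B.inner) (h₂ : A.outer = B.outer) : A = B := by
  cases A; cases B; simp_all

lemma Sub.rfl {A : Biset V} : Sub A A := ⟨Finset.Subset.refl _, Finset.Subset.refl _⟩

lemma Sub.trans {A B C : Biset V} (h : Sub A B) (h' : Sub B C) : Sub A C :=
  ⟨h.1.trans h'.1, h.2.trans h'.2⟩

lemma Sub.antisymm {A B : Biset V} (h : Sub A B) (h' : Sub B A) : A = B :=
  ext_parts (h.1.antisymm h'.1) (h.2.antisymm h'.2)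

/-- The total size of the two parts of a biset. -/
def size (A : Biset V) : ℕ := A.inner.card + A.outer.card

lemma Sub.size_lt {A B : Biset V} (h : Sub A B) (hne : A ≠ B) : A.size < B.size := by
  have h1 := Finset.card_le_card h.1
  have h2 := Finset.card_le_card h.2
  by_contra hlt
  unfold size at hlt
  exact hne (ext_parts (Finset.eq_of_subset_of_card_le h.1 (by omega))
    (Finset.eq_of_subset_of_card_le h.2 (by omega)))

variable [DecidableEq V]

/-- Two bisets do not cross: they are nested or strongly disjoint. -/
def Uncrossed (A B : Biset V) : Prop :=
  Sub A B ∨ Sub B A ∨ (A.inner ∩ B.outer = ∅ ∧ B.inner ∩ A.outer = ∅)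

lemma Uncrossed.symm {A B : Biset V} (h : Uncrossed A B) : Uncrossed B A := by
  rcases h with h | h | h
  · exact Or.inr (Or.inl h)
  · exact Or.inl h
  · exact Or.inr (Or.inr h.symm)

lemma Uncrossed.self (A : Biset V) : Uncrossed A A := Or.inl Sub.rfl

lemma Uncrossed.inter {A S T : Biset V} (hA : Uncrossed T A) (hS : Uncrossed T S) :
    Uncrossed T (inter A S) := by
  simp only [Uncrossed, Sub, Biset.inter, Finset.subset_iff, Finset.ext_iff, Finset.mem_inter,
    Finset.notMem_empty, iff_false] at *
  grind

lemma Uncrossed.union {A S T : Biset V} (hA : Uncrossed T A) (hS : Uncrossed T S)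
    (hc : ¬ Uncrossed S A) : Uncrossed T (union A S) := by
  simp only [Uncrossed, Sub, Biset.union, Finset.subset_iff, Finset.ext_iff, Finset.mem_inter,
    Finset.mem_union, Finset.notMem_empty, iff_false] at *
  rcases hA with hA | hA | hA <;> rcases hS with hS | hS | hS
  · left; grind
  · left; grind
  · left; grind
  · left; grind
  · right; left; grind
  · exact absurd (Or.inr (Or.inr (by grind))) hc
  · left; grind
  · exact absurd (Or.inr (Or.inr (by grind))) hc
  · right; right; grind

lemma Uncrossed.diff {A S T : Biset V} (hA : Uncrossed T A) (hS : Uncrossed T S)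
    (hc : ¬ Uncrossed S A) : Uncrossed T (diff A S) := by
  have hA' := @A.subset
  have hS' := @S.subset
  have hT' := @T.subset
  simp only [Uncrossed, Sub, Biset.diff, Finset.subset_iff, Finset.ext_iff, Finset.mem_inter,
    Finset.mem_sdiff, Finset.notMem_empty, iff_false] at *
  rcases hA with hA | hA | hA <;> rcases hS with hS | hS | hS
  · right; right; grind
  · exact absurd (Or.inl (by grind)) hc
  · left; grind
  · right; right; grind
  · right; left; grind
  · exact absurd (Or.inr (Or.inr (by grind))) hc
  · right; right; grind
  · right; right; grind
  · right; right; grind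

end Biset

section Cover

open Biset

variable {V E : Type*} [DecidableEq V] [Fintype E]

/-- The edges covering a biset, where `p e true` and `p e false` are the end-nodes of `e`. -/
def cover (p : E → Bool → V) (A : Biset V) : Finset E :=
  Finset.univ.filter fun e => ∃ b, p e b ∈ A.inner ∧ p e (!b) ∉ A.outer

lemma mem_cover {p : E → Bool → V} {A : Biset V} {e : E} :
    e ∈ cover p A ↔ ∃ b, p e b ∈ A.inner ∧ p e (!b) ∉ A.outer := by
  simp [cover]

lemma incVec_cover_eq (p : E → Bool → V) (A : Biset V) (e : E) :
    incVec (cover p A) e =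
      (((decide (p e false ∈ A.inner) && !decide (p e true ∈ A.outer)) ||
        (decide (p e true ∈ A.inner) && !decide (p e false ∈ A.outer))).toNat : ℝ) := by
  have h : ∀ c : Bool, (c.toNat : ℝ) = if c = true then 1 else 0 := by
    intro c; cases c <;> simp
  rw [h]
  simp only [incVec, mem_cover, Bool.exists_bool, Bool.not_true, Bool.not_false, Bool.or_eq_true,
    Bool.and_eq_true, Bool.not_eq_true', decide_eq_true_eq, decide_eq_false_iff_not]

lemma incVec_cover_inter_union (p : E → Bool → V) (A B : Biset V) (e : E) :
    incVec (cover p (inter A B)) e + incVec (cover p (union A B)) e ≤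
      incVec (cover p A) e + incVec (cover p B) e := by
  have key : ∀ a b c d a' b' c' d' : Bool, (a → b) → (c → d) → (a' → b') → (c' → d') →
      (((a' && c') && !(b && d)) || ((a && c) && !(b' && d'))).toNat +
      (((a' || c') && !(b || d)) || ((a || c) && !(b' || d'))).toNat ≤
      ((a' && !b) || (a && !b')).toNat + ((c' && !d) || (c && !d')).toNat := by decide
  simp only [incVec_cover_eq, inter, union, Finset.mem_inter, Finset.mem_union,
    Bool.decide_and, Bool.decide_or]
  exact_mod_cast key _ _ _ _ _ _ _ _ (by simpa using @A.subset _) (by simpa using @B.subset _)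
    (by simpa using @A.subset _) (by simpa using @B.subset _)

lemma incVec_cover_diff (p : E → Bool → V) (A B : Biset V) (e : E) :
    incVec (cover p (diff A B)) e + incVec (cover p (diff B A)) e ≤
      incVec (cover p A) e + incVec (cover p B) e := by
  have key : ∀ a b c d a' b' c' d' : Bool, (a → b) → (c → d) → (a' → b') → (c' → d') →
      (((a' && !d') && !(b && !c)) || ((a && !d) && !(b' && !c'))).toNat +
      (((c' && !b') && !(d && !a)) || ((c && !b) && !(d' && !a'))).toNat ≤
      ((a' && !b) || (a && !b')).toNat + ((c' && !d) || (c && !d')).toNat := by decide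
  simp only [incVec_cover_eq, diff, Finset.mem_sdiff, Bool.decide_and, decide_not]
  exact_mod_cast key _ _ _ _ _ _ _ _ (by simpa using @A.subset _) (by simpa using @B.subset _)
    (by simpa using @A.subset _) (by simpa using @B.subset _)

lemma uDelta_eq_cover (ep1 ep2 : E → V) (A : Biset V) :
    uDelta ep1 ep2 A = cover (fun e c => cond c (ep1 e) (ep2 e)) A := by
  ext e
  simp [uDelta, mem_cover, or_comm]

end Cover

namespace Biset

variable {V : Type*} {L : Finset (Biset V)}

/-- The maximal members of `L` properly contained in `S`. -/
def kids (L : Finset (Biset V)) (S : Biset V) : Finset (Biset V) :=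
  L.filter fun R => R ≠ S ∧ Sub R S ∧ ∀ T ∈ L, Sub R T → Sub T S → T = R ∨ T = S

lemma mem_kids {S R : Biset V} :
    R ∈ kids L S ↔ R ∈ L ∧ R ≠ S ∧ Sub R S ∧ ∀ T ∈ L, Sub R T → Sub T S → T = R ∨ T = S := by
  simp [kids]

lemma kids_subset (S : Biset V) : kids L S ⊆ L := Finset.filter_subset _ _

/-- The inner nodes of `S` lying in no member of `L` properly contained in `S`. -/
def own (L : Finset (Biset V)) (S : Biset V) : Finset V :=
  S.inner.filter fun v => ∀ R ∈ L, Sub R S → R ≠ S → v ∉ R.inner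

lemma mem_own {S : Biset V} {v : V} :
    v ∈ own L S ↔ v ∈ S.inner ∧ ∀ R ∈ L, Sub R S → R ≠ S → v ∉ R.inner := by
  simp [own]

lemma exists_kid {S T : Biset V} (hT : T ∈ L) (hTS : Sub T S) (hne : T ≠ S) :
    ∃ R ∈ kids L S, Sub T R := by
  obtain ⟨R, hR, hmax⟩ := (L.filter fun R => Sub T R ∧ Sub R S ∧ R ≠ S).exists_max_image size
    ⟨T, by simp [hT, hTS, hne, Sub.rfl]⟩
  simp only [Finset.mem_filter] at hR hmax
  refine ⟨R, mem_kids.2 ⟨hR.1, hR.2.2.2, hR.2.2.1, fun U hU h1 h2 => ?_⟩, hR.2.1⟩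
  by_contra hcon
  push Not at hcon
  have := hmax U ⟨hU, hR.2.1.trans h1, h2, hcon.2⟩
  have := h1.size_lt hcon.1.symm
  omega

lemma exists_parent {S T : Biset V} (hT : T ∈ L) (hS : S ∈ L) (hTS : Sub T S) (hne : T ≠ S) :
    ∃ R ∈ L, T ∈ kids L R := by
  obtain ⟨R, hR, hmin⟩ := (L.filter fun R => Sub T R ∧ R ≠ T).exists_min_image size
    ⟨S, by simp [hS, hTS, hne.symm]⟩
  simp only [Finset.mem_filter] at hR hmin
  refine ⟨R, hR.1, mem_kids.2 ⟨hT, hR.2.2.symm, hR.2.1, fun U hU h1 h2 => ?_⟩⟩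
  by_contra hcon
  push Not at hcon
  have := hmin U ⟨hU, h1, hcon.1⟩
  have := h2.size_lt hcon.2
  omega

lemma mem_own_of_kids {S : Biset V} {v : V} (hv : v ∈ S.inner)
    (h : ∀ R ∈ kids L S, v ∉ R.inner) : v ∈ own L S := by
  refine mem_own.2 ⟨hv, fun T hT hTS hne hvT => ?_⟩
  obtain ⟨R, hR, hTR⟩ := exists_kid hT hTS hne
  exact h R hR (hTR.1 hvT)

/-- The maximal members of `L`. -/
def tops (L : Finset (Biset V)) : Finset (Biset V) :=
  L.filter fun T => ∀ S ∈ L, Sub T S → T = S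

variable [DecidableEq V]

lemma StronglyLaminar.nested (hL : StronglyLaminar L) {A B : Biset V} (hA : A ∈ L) (hB : B ∈ L)
    {v : V} (hv : v ∈ A.inner) (hv' : v ∈ B.outer) : Sub A B ∨ Sub B A := by
  rcases hL A hA B hB with h | h | h
  · exact Or.inl h
  · exact Or.inr h
  · have : v ∈ A.inner ∩ B.outer := Finset.mem_inter.2 ⟨hv, hv'⟩
    simp [h.1] at this

lemma kids_disjoint_outer (hL : StronglyLaminar L) {S R R' : Biset V} (hR : R ∈ kids L S)
    (hR' : R' ∈ kids L S) (hne : R ≠ R') : R.inner ∩ R'.outer = ∅ := by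
  rw [mem_kids] at hR hR'
  rcases hL R hR.1 R' hR'.1 with h | h | h
  · rcases hR.2.2.2 R' hR'.1 h hR'.2.2.1 with h | h
    · exact absurd h.symm hne
    · exact absurd h hR'.2.1
  · rcases hR'.2.2.2 R hR.1 h hR.2.2.1 with h | h
    · exact absurd h hne
    · exact absurd h hR.2.1
  · exact h.1

lemma parent_unique (hL : StronglyLaminar L) {S S' R : Biset V} (hne : R.inner.Nonempty)
    (hS : S ∈ L) (hS' : S' ∈ L) (h : R ∈ kids L S) (h' : R ∈ kids L S') : S = S' := by
  rw [mem_kids] at h h'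
  obtain ⟨v, hv⟩ := hne
  rcases hL.nested hS hS' (h.2.2.1.1 hv) (h'.2.2.1.2 (R.subset hv)) with hs | hs
  · rcases h'.2.2.2 S hS h.2.2.1 hs with h1 | h1
    · exact absurd h1.symm h.2.1
    · exact h1
  · rcases h.2.2.2 S' hS' h'.2.2.1 hs with h1 | h1
    · exact absurd h1.symm h'.2.1
    · exact h1.symm

lemma own_unique (hL : StronglyLaminar L) {S S' : Biset V} (hS : S ∈ L) (hS' : S' ∈ L) {v : V}
    (h : v ∈ own L S) (h' : v ∈ own L S') : S = S' := by
  rw [mem_own] at h h'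
  rcases hL.nested hS hS' h.1 (S'.subset h'.1) with hs | hs
  · by_contra hne
    exact h'.2 S hS hs hne h.1
  · by_contra hne
    exact h.2 S' hS' hs (Ne.symm hne) h'.1

lemma tops_disjoint_outer (hL : StronglyLaminar L) {R R' : Biset V} (hR : R ∈ tops L)
    (hR' : R' ∈ tops L) (hne : R ≠ R') : R.inner ∩ R'.outer = ∅ := by
  simp only [tops, Finset.mem_filter] at hR hR'
  rcases hL R hR.1 R' hR'.1 with h | h | h
  · exact absurd (hR.2 R' hR'.1 h) hne
  · exact absurd (hR'.2 R hR.1 h) hne.symm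
  · exact h.1

/-- A member is a top or a kid of a member, but not both. -/
lemma sum_kids_add_sum_tops (hL : StronglyLaminar L) (hne : ∀ S ∈ L, S.inner.Nonempty)
    {M : Type*} [AddCommMonoid M] (g : Biset V → M) :
    ∑ S ∈ L, ∑ R ∈ kids L S, g R + ∑ T ∈ tops L, g T = ∑ S ∈ L, g S := by
  have hdisj : (L : Set (Biset V)).PairwiseDisjoint (kids L) := by
    intro S hS S' hS' hSS'
    refine Finset.disjoint_left.2 fun R h h' => hSS' ?_
    exact parent_unique hL (hne R (kids_subset S h)) hS hS' h h'
  rw [← Finset.sum_biUnion hdisj, ← Finset.sum_filter_not_add_sum_filter L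
    (fun T => ∀ S ∈ L, Sub T S → T = S)]
  congr 1
  refine Finset.sum_congr ?_ fun _ _ => rfl
  ext T
  simp only [Finset.mem_biUnion, Finset.mem_filter]
  constructor
  · rintro ⟨S, hS, hTS⟩
    have hTS' := mem_kids.1 hTS
    exact ⟨hTS'.1, fun h => hTS'.2.1 (h S hS hTS'.2.2.1)⟩
  · rintro ⟨hT, h⟩
    push Not at h
    obtain ⟨S, hS, hTS, hne'⟩ := h
    exact exists_parent hT hS hTS hne'

end Biset

section Tokens

open Biset

variable {V E : Type*} [DecidableEq V] [Fintype E] {p : E → Bool → V} {L : Finset (Biset V)}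

/-- The edges covering a kid of `S` but not `S` itself. -/
def drop (p : E → Bool → V) (L : Finset (Biset V)) (S : Biset V) : Finset E :=
  Finset.univ.filter fun e => e ∉ cover p S ∧ ∃ R ∈ kids L S, e ∈ cover p R

lemma mem_drop {S : Biset V} {e : E} :
    e ∈ drop p L S ↔ e ∉ cover p S ∧ ∃ R ∈ kids L S, e ∈ cover p R := by
  simp [drop]

lemma end_mem_of_drop {S R : Biset V} (hRS : Sub R S) {e : E} (he : e ∉ cover p S) {b : Bool}
    (hb : p e b ∈ R.inner) : p e (!b) ∈ S.outer := by
  by_contra h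
  exact he (mem_cover.2 ⟨b, hRS.1 hb, h⟩)

lemma sub_of_mem_drop (hL : StronglyLaminar L) {S T : Biset V} (hS : S ∈ L) (hT : T ∈ L)
    {e : E} (he : e ∈ drop p L S) (heT : e ∈ cover p T) : Sub T S ∧ T ≠ S := by
  obtain ⟨heS, R, hR, heR⟩ := mem_drop.1 he
  obtain ⟨hRL, -, hRS, -⟩ := mem_kids.1 hR
  have hne : T ≠ S := by rintro rfl; exact heS heT
  refine ⟨?_, hne⟩
  obtain ⟨b, hb, hb'⟩ := mem_cover.1 heR
  obtain ⟨c, hc, hc'⟩ := mem_cover.1 heT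
  have h1 : p e b ∈ S.outer := S.subset (hRS.1 hb)
  have h2 : p e (!b) ∈ S.outer := end_mem_of_drop hRS heS hb
  have h3 : p e c ∈ S.outer ∧ p e (!c) ∈ S.outer := by
    cases b <;> cases c <;> simp_all
  rcases hL.nested hT hS hc h3.1 with h | h
  · exact h
  · exact absurd (h.2 h3.2) hc'

lemma drop_disjoint (hL : StronglyLaminar L) {S S' : Biset V} (hS : S ∈ L) (hS' : S' ∈ L)
    {e : E} (he : e ∈ drop p L S) (he' : e ∈ drop p L S') : S = S' := by
  obtain ⟨heS, R, hR, heR⟩ := mem_drop.1 he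
  obtain ⟨heS', R', hR', heR'⟩ := mem_drop.1 he'
  have h1 := sub_of_mem_drop hL hS' (kids_subset _ hR) he' heR
  have h2 := sub_of_mem_drop hL hS (kids_subset _ hR') he heR'
  rw [mem_kids] at hR hR'
  obtain ⟨b, hb, hb'⟩ := mem_cover.1 heR
  rcases hL.nested hS hS' (hR.2.2.1.1 hb) (S'.subset (h1.1.1 hb)) with h | h
  · rcases hR'.2.2.2 S hS h2.1 h with h' | h'
    · exact absurd h'.symm h2.2
    · exact h'
  · rcases hR.2.2.2 S' hS' h1.1 h with h' | h'
    · exact absurd h'.symm h1.2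
    · exact h'.symm

end Tokens

section Tokens

open Biset Finset

variable {V E : Type*} [DecidableEq V] [Fintype E]

/-- A strongly laminar family of tight bisets whose incidence vectors are independent in the weak
sense that no vector is a sum of others, for an edge weight `x` with values in `(0, 1/2)`. -/
structure TightFamily (p : E → Bool → V) (x : E → ℝ) (f : Biset V → ℤ)
    (L : Finset (Biset V)) : Prop where
  laminar : StronglyLaminar L
  nonempty : ∀ S ∈ L, S.inner.Nonempty
  tight : ∀ S ∈ L, ∑ e ∈ cover p S, x e = f S
  one_le : ∀ S ∈ L, 1 ≤ f S
  pos : ∀ e, 0 < x e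
  lt_half : ∀ e, x e < 1 / 2
  ne_sum : ∀ S ∈ L, ∀ K ⊆ L, S ∉ K → ∃ e,
    incVec (cover p S) e ≠ ∑ R ∈ K, incVec (cover p R) e

/-- The token count of `S`. -/
def tok (p : E → Bool → V) (f : Biset V → ℤ) (L : Finset (Biset V)) (S : Biset V) : ℤ :=
  f S - ∑ R ∈ kids L S, f R + (drop p L S).card

/-- The half-edges leaving `S` at a node owned by `S`. -/
def newH (p : E → Bool → V) (L : Finset (Biset V)) (S : Biset V) : Finset (E × Bool) :=
  univ.filter fun h => p h.1 h.2 ∈ own L S ∧ p h.1 (!h.2) ∉ S.outer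

/-- The edges covering `S` but no kid of `S`. -/
def fresh (p : E → Bool → V) (L : Finset (Biset V)) (S : Biset V) : Finset E :=
  cover p S \ (kids L S).biUnion (cover p)

variable {p : E → Bool → V} {x : E → ℝ} {f : Biset V → ℤ} {L : Finset (Biset V)}

lemma mem_newH {S : Biset V} {e : E} {b : Bool} :
    (e, b) ∈ newH p L S ↔ p e b ∈ own L S ∧ p e (!b) ∉ S.outer := by
  simp [newH]

lemma sum_incVec_cover (K : Finset (Biset V)) (e : E) :
    ∑ R ∈ K, incVec (cover p R) e = (K.filter fun R => e ∈ cover p R).card := by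
  simp [incVec, Finset.sum_boole]

lemma sum_cover_eq (x : E → ℝ) (F : Finset E) : ∑ e ∈ F, x e = ∑ e, x e * incVec F e := by
  simp [incVec, Finset.sum_ite_mem]

lemma card_filter_inner_le_one {K : Finset (Biset V)}
    (hK : ∀ R ∈ K, ∀ R' ∈ K, R ≠ R' → R.inner ∩ R'.outer = ∅) (v : V) :
    (K.filter fun R => v ∈ R.inner).card ≤ 1 := by
  rw [card_le_one]
  intro R hR R' hR'
  rw [mem_filter] at hR hR'
  by_contra hne
  have : v ∈ R.inner ∩ R'.outer := mem_inter.2 ⟨hR.2, R'.subset hR'.2⟩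
  simp [hK R hR.1 R' hR'.1 hne] at this

lemma card_filter_cover_le_two {K : Finset (Biset V)}
    (hK : ∀ R ∈ K, ∀ R' ∈ K, R ≠ R' → R.inner ∩ R'.outer = ∅) (e : E) :
    (K.filter fun R => e ∈ cover p R).card ≤ 2 := by
  have hsub : (K.filter fun R => e ∈ cover p R) ⊆
      (K.filter fun R => p e true ∈ R.inner) ∪ (K.filter fun R => p e false ∈ R.inner) := by
    intro R hR
    simp only [mem_filter, mem_cover, Bool.exists_bool, mem_union] at hR ⊢
    tauto
  have h1 := card_le_card hsub
  have h2 := card_union_le (K.filter fun R => p e true ∈ R.inner)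
    (K.filter fun R => p e false ∈ R.inner)
  have h3 := card_filter_inner_le_one hK (p e true)
  have h4 := card_filter_inner_le_one hK (p e false)
  omega

lemma card_filter_kids_cover_le_one (hL : StronglyLaminar L) {S : Biset V} {e : E}
    (he : e ∈ cover p S) : ((kids L S).filter fun R => e ∈ cover p R).card ≤ 1 := by
  obtain ⟨b, hb, hb'⟩ := mem_cover.1 he
  refine (card_le_card ?_).trans
    (card_filter_inner_le_one (K := kids L S)
      (fun R hR R' hR' => kids_disjoint_outer hL hR hR') (p e b))
  intro R hR
  rw [mem_filter] at hR ⊢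
  refine ⟨hR.1, ?_⟩
  obtain ⟨c, hc, hc'⟩ := mem_cover.1 hR.2
  have hRS := (mem_kids.1 hR.1).2.2.1
  have : c = b := by
    by_contra hne
    have : c = !b := by cases b <;> cases c <;> simp_all
    subst this
    exact hb' (S.subset (hRS.1 hc))
  exact this ▸ hc

lemma TightFamily.one_le_tok (h : TightFamily p x f L) {S : Biset V} (hS : S ∈ L) :
    1 ≤ tok p f L S := by
  set c : E → ℝ := fun e => x e * (incVec (cover p S) e - ∑ R ∈ kids L S, incVec (cover p R) e)
    + incVec (drop p L S) e with hc
  have hsum : (tok p f L S : ℝ) = ∑ e, c e := by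
    simp only [tok, hc, sum_add_distrib, mul_sub, sum_sub_distrib, Finset.mul_sum]
    rw [sum_comm]
    push_cast
    rw [← h.tight S hS, sum_cover_eq]
    congr 2
    · refine sum_congr rfl fun R hR => ?_
      rw [← h.tight R (kids_subset S hR), sum_cover_eq]
    · simp [incVec]
  have key : ∀ e, 0 ≤ c e ∧
      (c e = 0 → incVec (cover p S) e = ∑ R ∈ kids L S, incVec (cover p R) e) := by
    intro e
    have hx := h.pos e
    have hx' := h.lt_half e
    simp only [hc]
    rw [sum_incVec_cover]
    have h2 : (((kids L S).filter fun R => e ∈ cover p R).card : ℝ) ≤ 2 := by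
      exact_mod_cast card_filter_cover_le_two
        (fun R hR R' hR' => kids_disjoint_outer h.laminar hR hR') e
    by_cases he : e ∈ cover p S
    · have h1 : (((kids L S).filter fun R => e ∈ cover p R).card : ℝ) ≤ 1 := by
        exact_mod_cast card_filter_kids_cover_le_one h.laminar he
      have hd : e ∉ drop p L S := fun hd => (mem_drop.1 hd).1 he
      simp only [incVec, he, hd, if_true, if_false, add_zero]
      refine ⟨mul_nonneg hx.le (by linarith), fun h0 => ?_⟩
      rcases mul_eq_zero.1 h0 with h0 | h0 <;> linarith
    · by_cases hd : e ∈ drop p L S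
      · simp only [incVec, he, hd, if_true, if_false]
        have : x e * (0 - (((kids L S).filter fun R => e ∈ cover p R).card : ℝ)) + 1 > 0 := by
          nlinarith
        exact ⟨this.le, fun h0 => absurd h0 this.ne'⟩
      · have hm : ((kids L S).filter fun R => e ∈ cover p R) = ∅ := by
          refine filter_eq_empty_iff.2 fun R hR heR => hd (mem_drop.2 ⟨he, R, hR, heR⟩)
        simp [incVec, he, hd, hm]
  by_contra hlt
  have hle : (tok p f L S : ℝ) ≤ 0 := by exact_mod_cast (by omega : tok p f L S ≤ 0)
  have hz : ∑ e, c e = 0 := le_antisymm (hsum ▸ hle) (sum_nonneg fun e _ => (key e).1)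
  rw [sum_eq_zero_iff_of_nonneg fun e _ => (key e).1] at hz
  obtain ⟨e, he⟩ := h.ne_sum S hS (kids L S) (kids_subset S)
    (fun hSS => (mem_kids.1 hSS).2.1 rfl)
  exact he ((key e).2 (hz e (mem_univ e)))

lemma card_biUnion_drop (hL : StronglyLaminar L) :
    (L.biUnion (drop p L)).card = ∑ S ∈ L, (drop p L S).card := by
  refine card_biUnion fun S hS S' hS' hne => disjoint_left.2 fun e he he' => hne ?_
  exact drop_disjoint hL hS hS' he he'

lemma TightFamily.sum_tok_le (h : TightFamily p x f L) :
    ∑ S ∈ L, tok p f L S ≤ Fintype.card E := by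
  have h1 : ∑ S ∈ L, tok p f L S = ∑ T ∈ tops L, f T + (L.biUnion (drop p L)).card := by
    rw [card_biUnion_drop h.laminar]
    simp only [tok, sum_add_distrib, sum_sub_distrib]
    rw [← sum_kids_add_sum_tops h.laminar h.nonempty f]
    push_cast
    ring
  rw [h1]
  have h2 : ((∑ T ∈ tops L, f T : ℤ) : ℝ) =
      ∑ e, x e * ((tops L).filter fun R => e ∈ cover p R).card := by
    simp only [← sum_incVec_cover, Finset.mul_sum]
    rw [sum_comm]
    push_cast
    refine sum_congr rfl fun R hR => ?_
    rw [← h.tight R (mem_filter.1 hR).1, sum_cover_eq]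
  have h3 : ((L.biUnion (drop p L)).card : ℝ) = ∑ e, incVec (L.biUnion (drop p L)) e := by
    simp only [incVec, sum_boole, filter_mem_eq_inter, univ_inter]
  have h4 : ∀ e, x e * ((tops L).filter fun R => e ∈ cover p R).card +
      incVec (L.biUnion (drop p L)) e ≤ 1 := by
    intro e
    have hx := h.pos e
    have hx' := h.lt_half e
    by_cases hd : e ∈ L.biUnion (drop p L)
    · have : ((tops L).filter fun R => e ∈ cover p R) = ∅ := by
        refine filter_eq_empty_iff.2 fun R hR heR => ?_
        obtain ⟨S, hS, hd⟩ := mem_biUnion.1 hd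
        have hR' := mem_filter.1 hR
        have := sub_of_mem_drop h.laminar hS hR'.1 hd heR
        exact this.2 (hR'.2 S hS this.1)
      simp [incVec, hd, this]
    · have h2 : (((tops L).filter fun R => e ∈ cover p R).card : ℝ) ≤ 2 := by
        exact_mod_cast card_filter_cover_le_two
          (fun R hR R' hR' => tops_disjoint_outer h.laminar hR hR') e
      simp only [incVec, hd, if_false]
      nlinarith
  have h5 : ((∑ T ∈ tops L, f T + (L.biUnion (drop p L)).card : ℤ) : ℝ) ≤ Fintype.card E := by
    push_cast
    rw [← Int.cast_sum, h2, h3, ← sum_add_distrib]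
    exact (sum_le_sum fun e _ => h4 e).trans (by simp)
  exact_mod_cast h5

lemma card_fresh_le (S : Biset V) : (fresh p L S).card ≤ (newH p L S).card := by
  refine (card_le_card ?_).trans (card_image_le (f := Prod.fst))
  intro e he
  simp only [fresh, mem_sdiff, mem_biUnion, not_exists, not_and] at he
  obtain ⟨b, hb, hb'⟩ := mem_cover.1 he.1
  refine mem_image.2 ⟨(e, b), mem_newH.2 ⟨mem_own_of_kids hb fun R hR hbR => ?_, hb'⟩, rfl⟩
  exact he.2 R hR (mem_cover.2 ⟨b, hbR, fun h => hb' ((mem_kids.1 hR).2.2.1.2 h)⟩)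

lemma TightFamily.three_le_of_leaf (h : TightFamily p x f L) {S : Biset V} (hS : S ∈ L)
    (hk : (kids L S).card = 0) : 3 ≤ (newH p L S).card := by
  refine le_trans ?_ (card_fresh_le S)
  have hfr : fresh p L S = cover p S := by
    simp [fresh, card_eq_zero.1 hk]
  rw [hfr]
  have h1 : (1 : ℝ) ≤ ∑ e ∈ cover p S, x e := by
    rw [h.tight S hS]
    exact_mod_cast h.one_le S hS
  by_contra hlt
  have h2 : ∑ e ∈ cover p S, x e ≤ ∑ e ∈ cover p S, (1 / 2 : ℝ) :=
    sum_le_sum fun e _ => (h.lt_half e).le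
  have h3 : ((cover p S).card : ℝ) ≤ 2 := by exact_mod_cast (by omega : (cover p S).card ≤ 2)
  have hne : (cover p S).Nonempty := by
    by_contra hne
    rw [not_nonempty_iff_eq_empty.1 hne] at h1
    norm_num at h1
  have h4 := sum_lt_sum_of_nonempty hne fun e _ => h.lt_half e
  rw [sum_const, nsmul_eq_mul] at h4
  linarith

lemma TightFamily.fresh_of_tok_eq_one (h : TightFamily p x f L) {S : Biset V} (hS : S ∈ L)
    (hk : (kids L S).card = 1) (ht : tok p f L S = 1) :
    2 ≤ (newH p L S).card ∨ (1 ≤ (newH p L S).card ∧ (drop p L S).Nonempty) := by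
  have hle := card_fresh_le (p := p) (L := L) S
  obtain ⟨R, hR⟩ := card_eq_one.1 hk
  have hRL : R ∈ L := kids_subset S (by simp [hR])
  have hfr : fresh p L S = cover p S \ cover p R := by simp [fresh, hR]
  have hdr : drop p L S = cover p R \ cover p S := by
    ext e
    simp [mem_drop, hR, and_comm]
  have hsum : ∑ e ∈ fresh p L S, x e - ∑ e ∈ drop p L S, x e + (drop p L S).card = 1 := by
    have h1 : ((tok p f L S : ℤ) : ℝ) = 1 := by rw [ht]; simp
    simp only [tok, hR, sum_singleton] at h1
    push_cast at h1
    rw [← h.tight S hS, ← h.tight R hRL] at h1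
    rw [hfr]
    have h2 := sum_sdiff_sub_sum_sdiff (s₁ := cover p R) (s₂ := cover p S) (f := x)
    rw [← hdr] at h2
    linarith
  have hhalf : ∀ F : Finset E, ∑ e ∈ F, x e ≤ F.card / 2 := by
    intro F
    have := sum_le_sum fun e (_ : e ∈ F) => (h.lt_half e).le
    rw [sum_const, nsmul_eq_mul] at this
    linarith
  rcases (drop p L S).eq_empty_or_nonempty with hd | hd
  · left
    rw [hd] at hsum
    have h1 := hhalf (fresh p L S)
    simp only [sum_empty, card_empty, Nat.cast_zero] at hsum
    have : (2 : ℝ) ≤ (fresh p L S).card := by linarith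
    have : 2 ≤ (fresh p L S).card := by exact_mod_cast this
    omega
  · right
    refine ⟨?_, hd⟩
    by_contra hlt
    have hf0 : fresh p L S = ∅ := card_eq_zero.1 (by omega)
    rw [hf0, sum_empty] at hsum
    have h1 := hhalf (drop p L S)
    have h2 : ((drop p L S).card : ℝ) ≤ 2 := by linarith
    have h3 := sum_lt_sum_of_nonempty hd fun e _ => h.lt_half e
    rw [sum_const, nsmul_eq_mul] at h3
    have h4 := sum_pos (fun e _ => h.pos e) hd
    have h5 : ((drop p L S).card : ℝ) < 2 := by linarith
    have h6 : (1 : ℝ) < ((drop p L S).card : ℝ) := by linarith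
    have h5' : (drop p L S).card < 2 := by exact_mod_cast h5
    have h6' : 1 < (drop p L S).card := by exact_mod_cast h6
    omega

end Tokens

section Counting

open Biset Finset

variable {V E : Type*} [DecidableEq V] [Fintype E] {p : E → Bool → V} {x : E → ℝ}
  {f : Biset V → ℤ} {L : Finset (Biset V)} {B : Finset V}

/-- The edges leaving some member of `L` at an owned node outside `B`. -/
def tailEdges (p : E → Bool → V) (L : Finset (Biset V)) (B : Finset V) : Finset E :=
  univ.filter fun e => ∃ S ∈ L, ∃ b, (e, b) ∈ newH p L S ∧ p e b ∉ B

lemma mem_tailEdges {e : E} :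
    e ∈ tailEdges p L B ↔ ∃ S ∈ L, ∃ b, (e, b) ∈ newH p L S ∧ p e b ∉ B := by
  simp [tailEdges]

/-- The nodes of `B` on the boundary of `S` that lie in no kid of `S`. -/
def startNodes (L : Finset (Biset V)) (B : Finset V) (S : Biset V) : Finset V :=
  (S.boundary ∩ B).filter fun v => ∀ R ∈ kids L S, v ∉ R.outer

lemma sum_newH_le (hL : StronglyLaminar L) (hinc : ∀ e, ∃ b, p e b ∈ B) :
    ∑ S ∈ L with ¬ (own L S ∩ B).Nonempty, (newH p L S).card ≤ (tailEdges p L B).card := by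
  rw [← card_biUnion]
  · have hB : ∀ e b, (e, b) ∈ (L.filter fun S => ¬ (own L S ∩ B).Nonempty).biUnion (newH p L) →
        p e b ∉ B := by
      intro e b h hb
      obtain ⟨S, hS, h⟩ := mem_biUnion.1 h
      exact (mem_filter.1 hS).2 ⟨_, mem_inter.2 ⟨(mem_newH.1 h).1, hb⟩⟩
    refine card_le_card_of_injOn Prod.fst ?_ ?_
    · rintro ⟨e, b⟩ h
      obtain ⟨S, hS, h'⟩ := mem_biUnion.1 (mem_coe.1 h)
      exact mem_coe.2 (mem_tailEdges.2 ⟨S, (mem_filter.1 hS).1, b, h', hB e b h⟩)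
    · rintro ⟨e, b⟩ h ⟨e', c⟩ h' heq
      obtain rfl : e = e' := heq
      have h1 := hB e b h
      have h2 := hB e c h'
      obtain ⟨d, hd⟩ := hinc e
      cases b <;> cases c <;> cases d <;> simp_all
  · intro S hS S' hS' hne
    refine disjoint_left.2 ?_
    rintro ⟨e, b⟩ h h'
    exact hne (own_unique hL (mem_filter.1 hS).1 (mem_filter.1 hS').1 (mem_newH.1 h).1
      (mem_newH.1 h').1)

lemma sum_own_inter_le (hL : StronglyLaminar L) :
    ∑ S ∈ L, (own L S ∩ B).card ≤ B.card := by
  rw [← card_biUnion]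
  · exact card_le_card (biUnion_subset.2 fun S _ => inter_subset_right)
  · intro S hS S' hS' hne
    refine disjoint_left.2 fun v h h' => hne ?_
    exact own_unique hL hS hS' (mem_inter.1 h).1 (mem_inter.1 h').1

lemma startNodes_nonempty_or (hL : StronglyLaminar L) (hinc : ∀ e, ∃ b, p e b ∈ B)
    {S R : Biset V} (hS : S ∈ L) (hk : kids L S = {R}) (hinn : ¬ (own L S ∩ B).Nonempty)
    (hd : (drop p L S).Nonempty) :
    (startNodes L B S).Nonempty ∨ (drop p L S \ tailEdges p L B).Nonempty := by
  obtain ⟨e, he⟩ := hd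
  obtain ⟨heS, R', hR', heR⟩ := mem_drop.1 he
  obtain rfl : R' = R := by simpa [hk] using hR'
  have hRS := (mem_kids.1 hR').2.2.1
  obtain ⟨b, hb, hb'⟩ := mem_cover.1 heR
  have hu := end_mem_of_drop hRS heS hb
  by_cases huB : p e (!b) ∈ B
  · left
    refine ⟨p e (!b), mem_filter.2 ⟨mem_inter.2 ⟨mem_sdiff.2 ⟨hu, fun huS => hinn ?_⟩, huB⟩, ?_⟩⟩
    · refine ⟨p e (!b), mem_inter.2 ⟨mem_own_of_kids huS ?_, huB⟩⟩
      simpa [hk] using fun h => hb' (R'.subset h)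
    · simpa [hk] using hb'
  · right
    refine ⟨e, mem_sdiff.2 ⟨he, fun hA => ?_⟩⟩
    have hwB : p e b ∈ B := by
      obtain ⟨d, hd⟩ := hinc e
      cases b <;> cases d <;> simp_all
    obtain ⟨T, hT, c, hc, hcB⟩ := mem_tailEdges.1 hA
    obtain rfl : c = !b := by cases b <;> cases c <;> simp_all
    obtain ⟨huT, hwT⟩ := mem_newH.1 hc
    rw [Bool.not_not] at hwT
    have huT' := (mem_own.1 huT).1
    rcases hL.nested hT hS huT' hu with h | h
    · rcases eq_or_ne T S with rfl | hne
      · exact hwT (hRS.2 (R'.subset hb))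
      · obtain ⟨Q, hQ, hTQ⟩ := exists_kid hT h hne
        obtain rfl : Q = R' := by simpa [hk] using hQ
        exact hb' (Q.subset (hTQ.1 huT'))
    · exact hwT (h.2 (hRS.2 (R'.subset hb)))

lemma sum_drop_sdiff_le (hL : StronglyLaminar L) :
    ∑ S ∈ L, (drop p L S \ tailEdges p L B).card ≤ (tailEdges p L B)ᶜ.card := by
  rw [← card_biUnion]
  · refine card_le_card (biUnion_subset.2 fun S _ e he => ?_)
    exact mem_compl.2 (mem_sdiff.1 he).2
  · intro S hS S' hS' hne
    refine disjoint_left.2 fun e h h' => hne ?_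
    exact drop_disjoint hL hS hS' (mem_sdiff.1 h).1 (mem_sdiff.1 h').1

lemma card_startNodes_add_le {S R : Biset V} (hk : kids L S = {R}) :
    (startNodes L B S).card + (R.boundary ∩ B).card ≤
      (S.boundary ∩ B).card + (own L S ∩ B).card := by
  have hR : R ∈ kids L S := by simp [hk]
  have hRS := (mem_kids.1 hR).2.2.1
  rw [← card_union_of_disjoint]
  · refine (card_le_card ?_).trans (card_union_le _ _)
    intro v hv
    rcases mem_union.1 hv with hv | hv
    · exact mem_union_left _ (mem_filter.1 hv).1
    · simp only [boundary, mem_inter, mem_sdiff, mem_union] at hv ⊢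
      by_cases hvS : v ∈ S.inner
      · exact Or.inr ⟨mem_own_of_kids hvS (by simpa [hk] using hv.1.2), hv.2⟩
      · exact Or.inl ⟨⟨hRS.2 hv.1.1, hvS⟩, hv.2⟩
  · refine disjoint_left.2 fun v hv hv' => ?_
    exact (mem_filter.1 hv).2 R hR (mem_sdiff.1 (mem_inter.1 hv').1).1

lemma sum_startNodes_le (hL : StronglyLaminar L) (hne : ∀ S ∈ L, S.inner.Nonempty) {g : ℕ}
    (hg : ∀ S ∈ L, S.boundary.card ≤ g) :
    ∑ S ∈ L with (kids L S).card = 1, (startNodes L B S).card ≤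
      g * (L.filter fun S => (kids L S).card ≠ 1).card + B.card := by
  set G : Biset V → ℕ := fun S => (S.boundary ∩ B).card with hG
  have hGg : ∀ S ∈ L, G S ≤ g := fun S hS => (card_le_card inter_subset_left).trans (hg S hS)
  have h1 : ∑ S ∈ L with (kids L S).card = 1, (startNodes L B S).card +
      ∑ S ∈ L with (kids L S).card = 1, ∑ R ∈ kids L S, G R ≤
      ∑ S ∈ L with (kids L S).card = 1, G S + B.card := by
    refine le_trans ?_ (Nat.add_le_add_left ((sum_le_sum_of_subset (filter_subset
      (fun S => (kids L S).card = 1) L)).trans (sum_own_inter_le hL)) _)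
    rw [← sum_add_distrib, ← sum_add_distrib]
    refine sum_le_sum fun S hS => ?_
    obtain ⟨R, hR⟩ := card_eq_one.1 (mem_filter.1 hS).2
    rw [hR, sum_singleton]
    exact card_startNodes_add_le hR
  have h2 := sum_kids_add_sum_tops hL hne G
  have h3 := sum_kids_add_sum_tops hL hne (fun _ => 1)
  rw [← sum_filter_add_sum_filter_not L fun S => (kids L S).card = 1] at h2 h3
  rw [← sum_filter_add_sum_filter_not L fun S => (kids L S).card = 1] at h2 h3
  simp only [← card_eq_sum_ones] at h3
  have h4 : ∑ S ∈ L with (kids L S).card = 1, (kids L S).card =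
      (L.filter fun S => (kids L S).card = 1).card := by
    rw [card_eq_sum_ones]
    exact sum_congr rfl fun S hS => (mem_filter.1 hS).2
  have h5 : ∑ S ∈ L with ¬ (kids L S).card = 1, ∑ R ∈ kids L S, G R ≤
      g * ∑ S ∈ L with ¬ (kids L S).card = 1, (kids L S).card := by
    rw [Finset.mul_sum]
    refine sum_le_sum fun S _ => ?_
    refine (sum_le_card_nsmul _ _ g fun R hR => hGg R (kids_subset S hR)).trans ?_
    rw [smul_eq_mul, mul_comm]
  have h6 : ∑ T ∈ tops L, G T ≤ g * (tops L).card := by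
    refine (sum_le_card_nsmul (tops L) _ g fun R hR => hGg R (mem_filter.1 hR).1).trans ?_
    rw [smul_eq_mul, mul_comm]
  have h7 : g * ∑ S ∈ L with ¬ (kids L S).card = 1, (kids L S).card + g * (tops L).card =
      g * (L.filter fun S => (kids L S).card ≠ 1).card := by
    rw [← mul_add]
    congr 1
    simp only [ne_eq]
    omega
  simp only [ne_eq] at h7 ⊢
  omega

lemma sum_degree_le (p : E → Bool → V) (L : Finset (Biset V)) (B : Finset V) :
    ∑ v ∈ B, (cover p (vertexBiset v)).card ≤ Fintype.card E + (tailEdges p L B)ᶜ.card := by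
  have h1 : ∑ v ∈ B, (cover p (vertexBiset v)).card =
      ∑ e, (B.filter fun v => e ∈ cover p (vertexBiset v)).card := by
    simp only [card_filter]
    rw [sum_comm]
    refine sum_congr rfl fun v _ => ?_
    rw [← card_filter, filter_mem_eq_inter, univ_inter]
  have h2 : Fintype.card E + (tailEdges p L B)ᶜ.card =
      ∑ e, (1 + if e ∈ (tailEdges p L B)ᶜ then 1 else 0) := by
    rw [sum_add_distrib, ← card_filter, filter_mem_eq_inter, univ_inter]
    simp
  rw [h1, h2]
  refine sum_le_sum fun e _ => ?_
  have hsub : (B.filter fun v => e ∈ cover p (vertexBiset v)) ⊆ {p e true, p e false} := by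
    intro v hv
    obtain ⟨b, hb, -⟩ := mem_cover.1 (mem_filter.1 hv).2
    have : p e b = v := by simpa [vertexBiset] using hb
    cases b <;> simp [this]
  by_cases he : e ∈ tailEdges p L B
  · obtain ⟨S, -, b, -, hb⟩ := mem_tailEdges.1 he
    have : (B.filter fun v => e ∈ cover p (vertexBiset v)) ⊆ {p e (!b)} := by
      intro v hv
      have h := hsub hv
      have hvB := (mem_filter.1 hv).1
      simp only [mem_insert, mem_singleton] at h ⊢
      cases b <;> rcases h with rfl | rfl <;> simp_all
    have := card_le_card this
    simp only [card_singleton] at this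
    omega
  · have h3 := (card_le_card hsub).trans card_le_two
    simpa [he] using h3

theorem TightFamily.sum_degree_le (h : TightFamily p x f L) (hinc : ∀ e, ∃ b, p e b ∈ B) {g : ℕ}
    (hg : ∀ S ∈ L, S.boundary.card ≤ g) (hE : Fintype.card E ≤ L.card + B.card) :
    ∑ v ∈ B, (cover p (vertexBiset v)).card ≤ (13 + 10 * g) * B.card := by
  refine (_root_.sum_degree_le p L B).trans ?_
  set k : Biset V → ℕ := fun S => (kids L S).card
  set inn : Biset V → Prop := fun S => (own L S ∩ B).Nonempty
  set t := tok p f L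
  set w : Biset V → ℕ := fun S => (newH p L S).card
  set n₀ := (L.filter fun S => k S = 0 ∧ ¬ inn S).card with hn₀
  set n₁ := (L.filter fun S => k S = 0 ∧ inn S).card with hn₁
  set br := (L.filter fun S => 2 ≤ k S).card with hbr
  set c := (L.filter fun S => k S = 1 ∧ inn S).card with hc
  set a := (L.filter fun S => k S = 1 ∧ ¬ inn S ∧ 2 ≤ t S).card with ha
  set d := (L.filter fun S => k S = 1 ∧ ¬ inn S ∧ ¬ 2 ≤ t S ∧ 2 ≤ w S).card with hd
  set q := (L.filter fun S => k S = 1 ∧ ¬ inn S ∧ ¬ 2 ≤ t S ∧ ¬ 2 ≤ w S).card with hq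
  have hA : 3 * n₀ + 2 * d + q ≤ (tailEdges p L B).card := by
    refine le_trans ?_ (sum_newH_le h.laminar hinc)
    rw [hn₀, hd, hq, sum_filter, card_filter, card_filter, card_filter, Finset.mul_sum,
      Finset.mul_sum, ← sum_add_distrib, ← sum_add_distrib]
    refine sum_le_sum fun S hS => ?_
    have h1 : k S = 0 → 3 ≤ w S := h.three_le_of_leaf hS
    have h2 : k S = 1 → ¬ 2 ≤ t S → 1 ≤ w S := by
      intro hk1 ht1
      have : 1 ≤ t S := h.one_le_tok hS
      rcases h.fresh_of_tok_eq_one hS hk1 (show t S = 1 by omega) with h' | h'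
      · exact le_trans (by norm_num) h'
      · exact h'.1
    change _ ≤ if ¬ inn S then w S else 0
    by_cases hP : inn S <;> simp only [hP, not_true, not_false_iff, and_true, and_false, true_and,
      false_and, if_true, if_false] <;> (try split_ifs) <;> omega
  have hA' : (tailEdges p L B).card + (tailEdges p L B)ᶜ.card = Fintype.card E :=
    card_add_card_compl _
  have hB : L.card + a ≤ Fintype.card E := by
    have h1 := h.sum_tok_le
    have h2 : ((L.card + a : ℕ) : ℤ) ≤ ∑ S ∈ L, tok p f L S := by
      rw [ha, card_filter, card_eq_sum_ones, ← sum_add_distrib]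
      push_cast
      refine sum_le_sum fun S hS => ?_
      have h3 := h.one_le_tok hS
      split_ifs with h4
      · exact h4.2.2
      · simpa using h3
    exact_mod_cast h2.trans h1
  have hC : L.card = n₀ + n₁ + br + q + d + a + c := by
    rw [hn₀, hn₁, hbr, hq, hd, ha, hc, card_eq_sum_ones]
    simp only [card_filter, ← sum_add_distrib]
    refine sum_congr rfl fun S _ => ?_
    by_cases hP : inn S <;> simp only [hP, not_true, not_false_iff, and_true, and_false, true_and,
      false_and, if_false] <;> split_ifs <;> omega
  have hD : q ≤ (tailEdges p L B)ᶜ.card +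
      ∑ S ∈ L with k S = 1, (startNodes L B S).card := by
    refine le_trans ?_ (Nat.add_le_add_right (sum_drop_sdiff_le h.laminar) _)
    rw [hq, card_filter, sum_filter, ← sum_add_distrib]
    refine sum_le_sum fun S hS => ?_
    by_cases h1 : k S = 1 ∧ ¬ inn S ∧ ¬ 2 ≤ t S ∧ ¬ 2 ≤ w S
    · rw [if_pos h1, if_pos h1.1]
      have h3 : 1 ≤ t S := h.one_le_tok hS
      rcases h.fresh_of_tok_eq_one hS h1.1 (show t S = 1 by omega) with h' | h'
      · exact absurd h' h1.2.2.2
      · obtain ⟨R, hR⟩ := card_eq_one.1 h1.1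
        rcases startNodes_nonempty_or h.laminar hinc hS hR h1.2.1 h'.2 with h4 | h4
        · exact le_add_left h4.card_pos
        · exact le_add_right h4.card_pos
    · rw [if_neg h1]
      exact Nat.zero_le _
  have hst := sum_startNodes_le (B := B) h.laminar h.nonempty hg
  have hN : (L.filter fun S => k S ≠ 1).card = n₀ + n₁ + br := by
    rw [hn₀, hn₁, hbr]
    simp only [card_filter, ← sum_add_distrib]
    refine sum_congr rfl fun S _ => ?_
    by_cases hP : inn S <;> simp only [hP, not_true, not_false_iff, and_true, and_false,
      if_false] <;> split_ifs <;> omega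
  have hBr : br ≤ n₀ + n₁ := by
    have h1 := sum_kids_add_sum_tops h.laminar h.nonempty (fun _ => 1)
    simp only [← card_eq_sum_ones] at h1
    have h2 : L.card + br ≤ ∑ S ∈ L, k S + (n₀ + n₁) := by
      rw [hn₀, hn₁, hbr, card_eq_sum_ones]
      simp only [card_filter, ← sum_add_distrib]
      refine sum_le_sum fun S _ => ?_
      by_cases hP : inn S <;> simp only [hP, not_true, not_false_iff, and_true, and_false,
        if_false] <;> split_ifs <;> omega
    change ∑ S ∈ L, k S + _ = _ at h1
    omega
  have hF : n₁ + c ≤ B.card := by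
    refine le_trans ?_ (sum_own_inter_le h.laminar)
    rw [hn₁, hc, card_filter, card_filter, ← sum_add_distrib]
    refine sum_le_sum fun S _ => ?_
    by_cases hP : inn S
    · have h1 : 1 ≤ (own L S ∩ B).card := Nonempty.card_pos hP
      simp only [hP, and_true]
      split_ifs <;> omega
    · simp [hP]
  change ∑ S ∈ L with k S = 1, (startNodes L B S).card ≤
    g * (L.filter fun S => k S ≠ 1).card + B.card at hst
  rw [hN] at hst
  have hmul : g * (n₀ + n₁ + br) ≤ g * (10 * B.card) := Nat.mul_le_mul_left _ (by omega)
  have : (13 + 10 * g) * B.card = 13 * B.card + g * (10 * B.card) := by ring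
  omega

end Counting

section Uncrossing

open Biset Finset

variable {V E : Type*} [DecidableEq V] [Fintype E] {p : E → Bool → V} {x : E → ℝ}
  {f : Biset V → ℤ}

lemma tight_of_incVec_le (hx : ∀ e, 0 < x e)
    (hcov : ∀ A, (f A : ℝ) ≤ ∑ e ∈ cover p A, x e) {A S P Q : Biset V}
    (hA : ∑ e ∈ cover p A, x e = f A) (hS : ∑ e ∈ cover p S, x e = f S)
    (hfle : f A + f S ≤ f P + f Q)
    (hle : ∀ e, incVec (cover p P) e + incVec (cover p Q) e ≤
      incVec (cover p A) e + incVec (cover p S) e) :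
    ∑ e ∈ cover p P, x e = f P ∧ ∑ e ∈ cover p Q, x e = f Q ∧
      incVec (cover p P) + incVec (cover p Q) = incVec (cover p A) + incVec (cover p S) := by
  have hfle' : (f A : ℝ) + f S ≤ f P + f Q := by exact_mod_cast hfle
  have hP := hcov P
  have hQ := hcov Q
  have hz : ∀ e ∈ univ, 0 ≤ x e * ((incVec (cover p A) e + incVec (cover p S) e) -
      (incVec (cover p P) e + incVec (cover p Q) e)) :=
    fun e _ => mul_nonneg (hx e).le (sub_nonneg.2 (hle e))
  have hsum : ∑ e, x e * ((incVec (cover p A) e + incVec (cover p S) e) -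
      (incVec (cover p P) e + incVec (cover p Q) e)) =
      (∑ e ∈ cover p A, x e + ∑ e ∈ cover p S, x e) -
      (∑ e ∈ cover p P, x e + ∑ e ∈ cover p Q, x e) := by
    simp only [sum_cover_eq x, mul_sub, mul_add, sum_add_distrib, sum_sub_distrib]
  have h0 := sum_nonneg hz
  rw [hsum] at h0
  refine ⟨by linarith, by linarith, ?_⟩
  have h1 := (sum_eq_zero_iff_of_nonneg hz).1 (by rw [hsum]; linarith)
  ext e
  rcases mul_eq_zero.1 (h1 e (mem_univ e)) with h2 | h2
  · exact absurd h2 (hx e).ne'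
  · simp only [Pi.add_apply]
    linarith

lemma exists_laminar_family [Fintype V] (hf : SkewSupermodular f) (hx : ∀ e, 0 < x e)
    (hcov : ∀ A, (f A : ℝ) ≤ ∑ e ∈ cover p A, x e) :
    ∃ L : Finset (Biset V), StronglyLaminar L ∧ (∀ S ∈ L, ∑ e ∈ cover p S, x e = f S) ∧
      LinearIndepOn ℝ (fun A : Biset V => (incVec (cover p A) : E → ℝ)) L ∧
      ∀ A : Biset V, ∑ e ∈ cover p A, x e = f A → (incVec (cover p A) : E → ℝ) ∈
        Submodule.span ℝ ((fun A : Biset V => (incVec (cover p A) : E → ℝ)) '' L) := by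
  set χ : Biset V → E → ℝ := fun A => incVec (cover p A)
  obtain ⟨L, hL, hmax⟩ := ((univ : Finset (Finset (Biset V))).filter fun L =>
    StronglyLaminar L ∧ (∀ S ∈ L, ∑ e ∈ cover p S, x e = f S) ∧
      LinearIndepOn ℝ χ (L : Set (Biset V))).exists_max_image card
    ⟨∅, mem_filter.2 ⟨mem_univ _, by simp [StronglyLaminar], by simp, by simp⟩⟩
  simp only [mem_filter, mem_univ, true_and] at hL hmax
  obtain ⟨hlam, htight, hind⟩ := hL
  refine ⟨L, hlam, htight, hind, ?_⟩
  by_contra hcon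
  push Not at hcon
  set bad := (univ : Finset (Biset V)).filter fun A =>
    ∑ e ∈ cover p A, x e = f A ∧ χ A ∉ Submodule.span ℝ (χ '' L) with hbad
  obtain ⟨A, hA, hmin⟩ := bad.exists_min_image
    (fun A => (L.filter fun S => ¬ Uncrossed S A).card) (by
      obtain ⟨A, hA⟩ := hcon
      exact ⟨A, by simpa [hbad] using hA⟩)
  obtain ⟨hAt, hAs⟩ : ∑ e ∈ cover p A, x e = f A ∧ χ A ∉ Submodule.span ℝ (χ '' L) := by
    simpa [hbad] using hA
  rcases (L.filter fun S => ¬ Uncrossed S A).eq_empty_or_nonempty with h0 | ⟨S, hS⟩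
  · have hun : ∀ S ∈ L, Uncrossed S A := by
      intro S hS
      by_contra hc
      have : S ∈ L.filter fun S => ¬ Uncrossed S A := mem_filter.2 ⟨hS, hc⟩
      simp [h0] at this
    have hAL : A ∉ L := fun hAL => hAs (Submodule.subset_span ⟨A, hAL, rfl⟩)
    have := hmax (insert A L) ⟨?_, ?_, ?_⟩
    · rw [card_insert_of_notMem hAL] at this
      omega
    · intro S hS T hT
      rw [mem_insert] at hS hT
      rcases hS with rfl | hS <;> rcases hT with rfl | hT
      · exact Uncrossed.self _
      · exact (hun T hT).symm
      · exact hun S hS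
      · exact hlam S hS T hT
    · intro S hS
      rcases mem_insert.1 hS with rfl | hS
      · exact hAt
      · exact htight S hS
    · rw [coe_insert]
      exact hind.insert hAs
  · obtain ⟨hSL, hSA⟩ := mem_filter.1 hS
    have hSs : χ S ∈ Submodule.span ℝ (χ '' L) := Submodule.subset_span ⟨S, hSL, rfl⟩
    have done : ∀ P Q : Biset V, ∑ e ∈ cover p P, x e = f P → ∑ e ∈ cover p Q, x e = f Q →
        χ P + χ Q = χ A + χ S →
        (∀ T ∈ L, Uncrossed T A → Uncrossed T P ∧ Uncrossed T Q) →
        Uncrossed S P → Uncrossed S Q → False := by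
      intro P Q hP hQ hsum hT hSP hSQ
      have hlt : ∀ R, (∀ T ∈ L, Uncrossed T A → Uncrossed T R) → Uncrossed S R →
          ∑ e ∈ cover p R, x e = f R → χ R ∈ Submodule.span ℝ (χ '' L) := by
        intro R hTR hSR hR
        by_contra hRs
        have hle := hmin R (by simp [hbad, hR, hRs])
        refine absurd (card_lt_card ?_) (not_lt.2 hle)
        refine ⟨fun T hT => ?_, fun hsub => ?_⟩
        · obtain ⟨hTL, hTR'⟩ := mem_filter.1 hT
          exact mem_filter.2 ⟨hTL, fun hTA => hTR' (hTR T hTL hTA)⟩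
        · exact (mem_filter.1 (hsub hS)).2 hSR
      have h1 := hlt P (fun T hTL hTA => (hT T hTL hTA).1) hSP hP
      have h2 := hlt Q (fun T hTL hTA => (hT T hTL hTA).2) hSQ hQ
      have h3 : χ A = χ P + χ Q - χ S := by rw [hsum]; abel
      exact hAs (h3 ▸ Submodule.sub_mem _ (Submodule.add_mem _ h1 h2) hSs)
    have hAS : ¬ Uncrossed A S := fun h => hSA h.symm
    rcases hf A S with h | h
    · obtain ⟨h1, h2, h3⟩ := tight_of_incVec_le hx hcov hAt (htight S hSL) h
        (incVec_cover_inter_union p A S)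
      refine done _ _ h1 h2 h3 (fun T hT hTA => ?_) ?_ ?_
      · exact ⟨hTA.inter (hlam T hT S hSL), hTA.union (hlam T hT S hSL) hSA⟩
      · exact Or.inr (Or.inl ⟨inter_subset_right, inter_subset_right⟩)
      · exact Or.inl ⟨subset_union_right, subset_union_right⟩
    · obtain ⟨h1, h2, h3⟩ := tight_of_incVec_le hx hcov hAt (htight S hSL) h
        (incVec_cover_diff p A S)
      refine done _ _ h1 h2 h3 (fun T hT hTA => ?_) ?_ ?_
      · exact ⟨hTA.diff (hlam T hT S hSL) hSA, Uncrossed.diff (hlam T hT S hSL) hTA hAS⟩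
      · refine Or.inr (Or.inr ⟨?_, ?_⟩)
        · simp [Biset.diff]
        · simp [Biset.diff]
      · exact Or.inr (Or.inl ⟨sdiff_subset, fun v hv => (mem_sdiff.1 hv).1⟩)

end Uncrossing

section Extreme

open Biset Finset Filter Topology

variable {V E : Type*} [Fintype V] [DecidableEq V] [Fintype E]

lemma span_tight_eq_top {ep1 ep2 : E → V} {f : Biset V → ℤ} {B : Finset V} {b : V → ℕ} {x : E → ℝ}
    (hx : x ∈ Set.extremePoints ℝ (undirP ep1 ep2 f B b)) (hpos : ∀ e, 0 < x e)
    (hlt : ∀ e, x e < 1) :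
    Submodule.span ℝ ((fun A : Biset V => (incVec (uDelta ep1 ep2 A) : E → ℝ)) ''
      ({A | ∑ e ∈ uDelta ep1 ep2 A, x e = f A} ∪ vertexBiset '' B)) = ⊤ := by
  rw [mem_extremePoints] at hx
  obtain ⟨hxP, hext⟩ := hx
  by_contra hne
  obtain ⟨φ, hφ, hker⟩ := Submodule.exists_le_ker_of_lt_top _ (lt_top_iff_ne_top.2 hne)
  set d : E → ℝ := fun e => φ (Pi.single e 1) with hd
  have hφd : ∀ y : E → ℝ, φ y = ∑ e, y e * d e := fun y => by
    rw [LinearMap.pi_apply_eq_sum_univ]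
    simp only [smul_eq_mul, hd]
    refine sum_congr rfl fun e _ => ?_
    congr 2
    ext i
    simp [Pi.single_apply, eq_comm]
  have hd0 : d ≠ 0 := by
    intro h
    refine hφ (LinearMap.ext fun y => ?_)
    simp [hφd, h]
  have hzero : ∀ A : Biset V, (∑ e ∈ uDelta ep1 ep2 A, x e = f A ∨ A ∈ vertexBiset '' (B : Set V)) →
      ∑ e ∈ uDelta ep1 ep2 A, d e = 0 := by
    intro A hA
    have h1 : φ (incVec (uDelta ep1 ep2 A)) = 0 := hker (Submodule.subset_span ⟨A, hA, rfl⟩)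
    rw [hφd] at h1
    simpa [incVec, Finset.sum_ite_mem] using h1
  have hsum : ∀ (F : Finset E) (t : ℝ), ∑ e ∈ F, (x + t • d) e =
      ∑ e ∈ F, x e + t * ∑ e ∈ F, d e := by
    intro F t
    simp [sum_add_distrib, Finset.mul_sum]
  have hcont : ∀ a c : ℝ, Tendsto (fun t : ℝ => a + t * c) (𝓝 0) (𝓝 a) := by
    intro a c
    have : Continuous fun t : ℝ => a + t * c := by fun_prop
    simpa using this.tendsto 0
  have hev : ∀ᶠ t : ℝ in 𝓝 0, x + t • d ∈ undirP ep1 ep2 f B b := by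
    have h1 : ∀ᶠ t : ℝ in 𝓝 0, ∀ e, 0 < x e + t * d e ∧ x e + t * d e < 1 := by
      rw [eventually_all]
      intro e
      exact ((hcont (x e) (d e)).eventually_const_lt (hpos e)).and
        ((hcont (x e) (d e)).eventually_lt_const (hlt e))
    have h2 : ∀ᶠ t : ℝ in 𝓝 0, ∀ A : Biset V,
        (f A : ℝ) ≤ ∑ e ∈ uDelta ep1 ep2 A, x e + t * ∑ e ∈ uDelta ep1 ep2 A, d e := by
      rw [eventually_all]
      intro A
      by_cases hA : ∑ e ∈ uDelta ep1 ep2 A, x e = f A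
      · refine Eventually.of_forall fun t => ?_
        rw [hzero A (Or.inl hA), hA]
        simp
      · have h3 := lt_of_le_of_ne (hxP.2.1 A) (Ne.symm hA)
        exact ((hcont _ _).eventually_const_lt h3).mono fun t ht => ht.le
    filter_upwards [h1, h2] with t ht1 ht2
    refine ⟨fun e => ⟨(ht1 e).1.le, (ht1 e).2.le⟩, fun A => ?_, fun v hv => ?_⟩
    · rw [hsum]
      exact ht2 A
    · rw [hsum, uDeg, hzero _ (Or.inr ⟨v, hv, rfl⟩), mul_zero, add_zero]
      exact hxP.2.2 v hv
  obtain ⟨ε, hε, hball⟩ := Metric.eventually_nhds_iff.1 hev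
  have h1 : x + (ε / 2) • d ∈ undirP ep1 ep2 f B b := hball (by
    rw [Real.dist_eq, sub_zero, abs_of_pos (by positivity)]; linarith)
  have h2 : x + (-(ε / 2)) • d ∈ undirP ep1 ep2 f B b := hball (by
    rw [Real.dist_eq, sub_zero, abs_neg, abs_of_pos (by positivity)]; linarith)
  have h3 := (hext _ h1 _ h2 ⟨1 / 2, 1 / 2, by norm_num, by norm_num, by norm_num, by
    ext e
    simp
    ring⟩).1
  have h4 : (ε / 2) • d = 0 := by simpa using h3
  rcases smul_eq_zero.1 h4 with h5 | h5
  · linarith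
  · exact hd0 h5

lemma exists_tightFamily {ep1 ep2 : E → V} {f : Biset V → ℤ} {B : Finset V} {b : V → ℕ}
    {x : E → ℝ} (hf : SkewSupermodular f)
    (hx : x ∈ Set.extremePoints ℝ (undirP ep1 ep2 f B b)) (hpos : ∀ e, 0 < x e)
    (hlt : ∀ e, x e < 1 / 2) :
    ∃ L : Finset (Biset V), TightFamily (fun e c => cond c (ep1 e) (ep2 e)) x f L ∧
      Fintype.card E ≤ L.card + B.card := by
  have htop := span_tight_eq_top hx hpos fun e => (hlt e).trans (by norm_num)
  simp only [uDelta_eq_cover] at htop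
  have hcov := hx.1.2.1
  simp only [uDelta_eq_cover] at hcov
  set p : E → Bool → V := fun e c => cond c (ep1 e) (ep2 e)
  obtain ⟨L, hlam, htight, hind, hspan⟩ := exists_laminar_family hf hpos hcov
  set χ : Biset V → E → ℝ := fun A => incVec (cover p A)
  have hne : ∀ S ∈ L, ∀ K ⊆ L, S ∉ K → ∃ e,
      incVec (cover p S) e ≠ ∑ R ∈ K, incVec (cover p R) e := by
    intro S hS K hK hSK
    by_contra hcon
    push Not at hcon
    have h1 : LinearIndepOn ℝ χ (insert S (K : Set (Biset V))) :=
      hind.mono (Set.insert_subset hS (by exact_mod_cast hK))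
    refine ((linearIndepOn_insert (by simpa using hSK)).1 h1).2 ?_
    have h2 : χ S = ∑ R ∈ K, χ R := by
      ext e
      rw [Finset.sum_apply]
      exact hcon e
    rw [h2]
    exact Submodule.sum_mem _ fun R hR => Submodule.subset_span ⟨R, hR, rfl⟩
  have hcovne : ∀ S ∈ L, (cover p S).Nonempty := by
    intro S hS
    obtain ⟨e, he⟩ := hne S hS ∅ (by simp) (by simp)
    refine ⟨e, ?_⟩
    by_contra h
    simp [incVec, h] at he
  refine ⟨L, ⟨hlam, fun S hS => ?_, htight, fun S hS => ?_, hpos, hlt, hne⟩, ?_⟩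
  · obtain ⟨e, he⟩ := hcovne S hS
    obtain ⟨c, hc, -⟩ := mem_cover.1 he
    exact ⟨_, hc⟩
  · have h1 := sum_pos (fun e _ => hpos e) (hcovne S hS)
    rw [htight S hS] at h1
    exact_mod_cast h1
  · have h1 : Submodule.span ℝ
        (((L.image χ ∪ B.image fun v => χ (vertexBiset v) : Finset (E → ℝ))) : Set (E → ℝ)) =
        ⊤ := by
      rw [eq_top_iff, ← htop, Submodule.span_le]
      rintro _ ⟨A, hA | ⟨v, hv, rfl⟩, rfl⟩
      · refine Submodule.span_mono ?_ (hspan A hA)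
        simp
      · refine Submodule.subset_span ?_
        rw [coe_union, coe_image, coe_image]
        exact Or.inr ⟨v, hv, rfl⟩
    have h2 := finrank_span_finset_le_card (R := ℝ) (L.image χ ∪ B.image fun v => χ (vertexBiset v))
    rw [Set.finrank, h1, finrank_top, Module.finrank_pi] at h2
    have h3 := card_union_le (L.image χ) (B.image fun v => χ (vertexBiset v))
    have h4 : (L.image χ).card ≤ L.card := card_image_le
    have h5 : (B.image fun v => χ (vertexBiset v)).card ≤ B.card := card_image_le
    omega

end Extreme

theorem stmt_2 {V E : Type*} [Fintype V] [DecidableEq V] [Fintype E] [Nonempty E]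
    (ep1 ep2 : E → V) (B : Finset V) (b : V → ℕ)
    (f : Biset V → ℤ) (hf : Biset.SkewSupermodular f)
    (hinc : ∀ e : E, ep1 e ∈ B ∨ ep2 e ∈ B)
    (x : E → ℝ) (hx : x ∈ Set.extremePoints ℝ (undirP ep1 ep2 f B b)) :
    (∃ e : E, x e = 0) ∨ (∃ e : E, 1 / 2 ≤ x e) ∨
    (∃ v ∈ B, ((uDeg ep1 ep2 v).card : ℝ) ≤
      1.5 * (gammaOf f : ℝ) ^ 2 + 7.5 * (gammaOf f : ℝ) + 16) := by
  by_contra! hcon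
  obtain ⟨hne, hlt, hdeg⟩ := hcon
  have hpos : ∀ e, 0 < x e := fun e => lt_of_le_of_ne (hx.1.1 e).1 (hne e).symm
  obtain ⟨L, hL, hE⟩ := exists_tightFamily hf hx hpos hlt
  have hinc' : ∀ e, ∃ c, cond c (ep1 e) (ep2 e) ∈ B := fun e => by simpa [or_comm] using hinc e
  have hsum := hL.sum_degree_le hinc' (g := gammaOf f) (fun S hS =>
    Finset.le_sup (f := fun A : Biset V => A.boundary.card)
      (Finset.mem_filter.2 ⟨Finset.mem_univ S, hL.one_le S hS⟩)) hE
  have hB : B.Nonempty := by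
    obtain ⟨c, hc⟩ := hinc' (Classical.arbitrary E)
    exact ⟨_, hc⟩
  have hlow := Finset.sum_lt_sum_of_nonempty hB hdeg
  simp only [uDeg, uDelta_eq_cover] at hlow
  rw [Finset.sum_const, nsmul_eq_mul] at hlow
  have hsum' : ∑ v ∈ B, ((cover (fun e c => cond c (ep1 e) (ep2 e))
      (Biset.vertexBiset v)).card : ℝ) ≤ (13 + 10 * gammaOf f) * B.card := by
    exact_mod_cast hsum
  have hcard : (0 : ℝ) < B.card := by exact_mod_cast hB.card_pos
  have hquad : (13 + 10 * (gammaOf f : ℝ)) ≤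
      1.5 * (gammaOf f : ℝ) ^ 2 + 7.5 * (gammaOf f : ℝ) + 16 := by
    nlinarith [sq_nonneg ((gammaOf f : ℝ) - 1)]
  have := mul_le_mul_of_nonneg_right hquad hcard.le
  linarith
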